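/- arXiv:math/0205183 — 3 statements merged into one kernel-verified Lean document; each statement's English description precedes it below -/
import Mathlib

section
/- There exists a threshold P such that for every real p > P and every real a with a > p/(2πe) + (log p)/(4πe) + 1, one has ζ(-p, a) < 0. In particular ζ(-p, ·) has no zeroes in this region for p sufficiently large. -/
open Real HurwitzZeta

/-- Real Hurwitz zeta: `hzeta s x` is the value at `s` of the analytic continuation of
`Σ_{r=0}^∞ (x+r)^{-s}` for `x ∈ (0,1]`. -/
noncomputable def hzeta (s x : ℝ) : ℝ := (hurwitzZeta (x : UnitAddCircle) (s : ℂ)).re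

/-- `zetaH p a = ζ(-p, a)` for `a > 0`: writing `a = n + b` with `n ∈ ℕ`, `b ∈ (0,1]`,
this is `hurwitzZeta (-p) b - Σ_{r=0}^{n-1} (r+b)^p`. -/
noncomputable def zetaH (p a : ℝ) : ℝ :=
  hzeta (-p) (a - (⌈a⌉₊ - 1 : ℕ)) -
    ∑ r ∈ Finset.range (⌈a⌉₊ - 1), ((r : ℝ) + (a - (⌈a⌉₊ - 1 : ℕ))) ^ p

/-- `Q p = 2·Γ(1+p)/(2π)^{1+p}`. -/
noncomputable def Q (p : ℝ) : ℝ := 2 * Real.Gamma (1 + p) / (2 * π) ^ (1 + p)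

open Filter Topology

lemma log_Gamma_bound : ∀ᶠ p : ℝ in atTop,
    Real.log (Real.Gamma (1 + p)) ≤
      (1 / 2) * Real.log (2 * π) + (1 / 2) * Real.log p + p * Real.log p - p + 0.04 := by
  have h1 : ∀ᶠ n : ℕ in atTop, Real.log (Stirling.stirlingSeq n) < Real.log (√π) + 0.02 := by
    have h := (Stirling.tendsto_stirlingSeq_sqrt_pi).log (by positivity)
    exact h.eventually_lt_const (by norm_num)
  have h2 := (tendsto_nat_floor_atTop (α := ℝ)).eventually h1
  filter_upwards [h2, eventually_ge_atTop (100 : ℝ)] with p hp hp100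
  set n := ⌊p⌋₊ with hn
  have hp0 : (0 : ℝ) < p := by linarith
  have hnp : (n : ℝ) ≤ p := Nat.floor_le hp0.le
  have hpn : p < n + 1 := Nat.lt_floor_add_one p
  have hn0 : (0 : ℝ) < n := by linarith
  have hnne : n ≠ 0 := by
    intro h; rw [h] at hn0; simp at hn0
  set t := p - n with ht
  have ht0 : 0 ≤ t := by linarith
  have ht1 : t ≤ 1 := by linarith
  have hconv := Real.convexOn_log_Gamma.2
    (show (n : ℝ) + 1 ∈ Set.Ioi (0 : ℝ) by simp only [Set.mem_Ioi]; linarith)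
    (show (n : ℝ) + 2 ∈ Set.Ioi (0 : ℝ) by simp only [Set.mem_Ioi]; linarith)
    (show 0 ≤ 1 - t by linarith) ht0 (by ring)
  have e1 : (1 - t) • ((n : ℝ) + 1) + t • ((n : ℝ) + 2) = 1 + p := by
    simp only [smul_eq_mul, ht]; ring
  rw [e1] at hconv
  have e2 : Real.Gamma ((n : ℝ) + 2) = ((n : ℝ) + 1) * Real.Gamma ((n : ℝ) + 1) := by
    rw [← Real.Gamma_add_one (by linarith)]; ring_nf
  have hG : 0 < Real.Gamma ((n : ℝ) + 1) := Real.Gamma_pos_of_pos (by linarith)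
  simp only [Function.comp, smul_eq_mul, e2] at hconv
  rw [Real.log_mul (by linarith) hG.ne', Real.Gamma_nat_eq_factorial] at hconv
  rw [Stirling.log_stirlingSeq_formula, Real.log_sqrt pi_pos.le,
    Real.log_mul (by norm_num) hn0.ne', Real.log_div hn0.ne' (Real.exp_pos 1).ne',
    Real.log_exp] at hp
  rw [Real.log_mul (by norm_num) pi_pos.ne']
  have hlog : Real.log n ≤ Real.log p := Real.log_le_log hn0 hnp
  have k1 : t - t ^ 2 / p ≤ n * (Real.log p - Real.log n) := by
    have := Real.one_sub_inv_le_log_of_pos (show 0 < p / n by positivity)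
    rw [Real.log_div hp0.ne' hn0.ne'] at this
    have h3 := mul_le_mul_of_nonneg_left this hn0.le
    refine le_trans (le_of_eq ?_) h3
    have : (n : ℝ) = p - t := by simp [ht]
    rw [inv_div, this]
    field_simp
    ring
  have k2 : t * (Real.log (n + 1) - Real.log p) ≤ 1 / p := by
    have h3 := Real.log_le_sub_one_of_pos (show 0 < ((n : ℝ) + 1) / p by positivity)
    rw [Real.log_div (by positivity) hp0.ne'] at h3
    have h4 : ((n : ℝ) + 1) / p - 1 ≤ 1 / p := by
      rw [div_sub_one hp0.ne']; gcongr; linarith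
    have h5 : 0 ≤ Real.log (n + 1) - Real.log p := by
      have := Real.log_le_log hp0 hpn.le
      linarith
    nlinarith
  have k3 : t ^ 2 / p ≤ 0.01 := by
    rw [div_le_iff₀ hp0]; nlinarith
  have k4 : 1 / p ≤ 0.01 := by
    rw [div_le_iff₀ hp0]; nlinarith
  have e3 : p * Real.log p = n * Real.log p + t * Real.log p := by rw [ht]; ring
  rw [e3]
  nlinarith

lemma norm_expZeta_le (x : ℝ) (p : ℝ) (hp : 1 ≤ p) :
    ‖expZeta (x : UnitAddCircle) ((1 + p : ℝ) : ℂ)‖ ≤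
      1 + (2 : ℝ) ^ (1 - p) * ∑' n : ℕ, 1 / (n : ℝ) ^ 2 := by
  have hs : 1 < (((1 + p : ℝ) : ℂ)).re := by rw [Complex.ofReal_re]; linarith
  have h := hasSum_expZeta_of_one_lt_re x hs
  have hS : HasSum (fun n : ℕ => 1 / (n : ℝ) ^ 2) (∑' n : ℕ, 1 / (n : ℝ) ^ 2) :=
    (Real.summable_one_div_nat_pow.2 (by norm_num)).hasSum
  have hB := (hasSum_ite_eq (1 : ℕ) (1 : ℝ)).add (hS.mul_left ((2 : ℝ) ^ (1 - p)))
  rw [← h.tsum_eq]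
  refine tsum_of_norm_bounded hB ?_
  intro n
  rw [norm_div]
  have h1 : ‖Complex.exp (2 * π * Complex.I * x * n)‖ = 1 := by
    have : (2 * π * Complex.I * x * n : ℂ) = ((2 * π * x * n : ℝ) : ℂ) * Complex.I := by
      push_cast; ring
    rw [this, Complex.norm_exp_ofReal_mul_I]
  rw [h1]
  rcases Nat.eq_zero_or_pos n with rfl | hn
  · have : ((1 + p : ℝ) : ℂ) ≠ 0 := by
      rw [Complex.ofReal_ne_zero]; linarith
    rw [Nat.cast_zero, Complex.zero_cpow this]
    simp
  · rw [Complex.norm_natCast_cpow_of_pos hn, Complex.ofReal_re]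
    have hn' : (0 : ℝ) < n := by exact_mod_cast hn
    by_cases h1 : n = 1
    · subst h1
      simp
      positivity
    · have hn2 : (2 : ℝ) ≤ n := by
        have : 2 ≤ n := by omega
        exact_mod_cast this
      simp only [h1, if_false, zero_add]
      have e1 : (n : ℝ) ^ (1 + p) = (n : ℝ) ^ (p - 1) * (n : ℝ) ^ 2 := by
        rw [← Real.rpow_natCast, ← Real.rpow_add hn']; norm_num; ring_nf
      have e2 : (2 : ℝ) ^ (1 - p) = 1 / (2 : ℝ) ^ (p - 1) := by
        rw [one_div, ← Real.rpow_neg (by norm_num)]; ring_nf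
      rw [e1, e2, ← one_div_mul_one_div]
      gcongr

lemma hzeta_bound (x p : ℝ) (hp : 1 ≤ p) :
    hzeta (-p) x ≤ (2 * π) ^ (-(1 + p)) * Real.Gamma (1 + p) *
      (2 * (1 + (2 : ℝ) ^ (1 - p) * ∑' n : ℕ, 1 / (n : ℝ) ^ 2)) := by
  have hfe := hurwitzZeta_one_sub (x : UnitAddCircle) (s := ((1 + p : ℝ) : ℂ))
    (by
      intro n h
      have := congrArg Complex.re h
      simp at this
      have hn : (0 : ℝ) ≤ n := Nat.cast_nonneg n
      linarith)
    (Or.inr (by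
      intro h
      have := congrArg Complex.re h
      simp at this
      linarith))
  have e1 : (1 : ℂ) - ((1 + p : ℝ) : ℂ) = ((-p : ℝ) : ℂ) := by push_cast; ring
  rw [e1] at hfe
  unfold hzeta
  refine (Complex.re_le_norm _).trans ?_
  rw [hfe, norm_mul, norm_mul, Complex.Gamma_ofReal, Complex.norm_real,
    Real.norm_of_nonneg (Real.Gamma_pos_of_pos (by linarith)).le]
  have e2 : ‖(2 * π : ℂ) ^ (-((1 + p : ℝ) : ℂ))‖ = (2 * π) ^ (-(1 + p)) := by
    have : (2 * π : ℂ) = ((2 * π : ℝ) : ℂ) := by push_cast; ring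
    rw [this, Complex.norm_cpow_eq_rpow_re_of_pos (by positivity)]
    simp
  rw [e2]
  have hG := (Real.Gamma_pos_of_pos (show 0 < 1 + p by linarith)).le
  gcongr
  refine (norm_add_le _ _).trans ?_
  rw [norm_mul, norm_mul]
  have e3 : ‖Complex.exp (-π * Complex.I * ((1 + p : ℝ) : ℂ) / 2)‖ = 1 := by
    have : (-π * Complex.I * ((1 + p : ℝ) : ℂ) / 2) = ((-π * (1 + p) / 2 : ℝ) : ℂ) * Complex.I := by
      push_cast; ring
    rw [this, Complex.norm_exp_ofReal_mul_I]
  have e4 : ‖Complex.exp (π * Complex.I * ((1 + p : ℝ) : ℂ) / 2)‖ = 1 := by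
    have : (π * Complex.I * ((1 + p : ℝ) : ℂ) / 2) = ((π * (1 + p) / 2 : ℝ) : ℂ) * Complex.I := by
      push_cast; ring
    rw [this, Complex.norm_exp_ofReal_mul_I]
  rw [e3, e4]
  have b1 := norm_expZeta_le x p hp
  have b2 := norm_expZeta_le (-x) p hp
  rw [AddCircle.coe_neg] at b2
  linarith

theorem stmt_2 :
    ∃ P : ℝ, ∀ p : ℝ, P < p → ∀ a : ℝ,
      a > p / (2 * π * Real.exp 1) + Real.log p / (4 * π * Real.exp 1) + 1 →
        zetaH p a < 0 := by
  have hZ : ∀ᶠ p : ℝ in atTop,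
      (2 : ℝ) ^ (1 - p) * ∑' n : ℕ, 1 / (n : ℝ) ^ 2 < 0.01 := by
    have h : Tendsto (fun p : ℝ => (2 : ℝ) ^ (1 - p)) atTop (𝓝 0) := by
      have h0 := tendsto_rpow_atBot_of_base_gt_one (2 : ℝ) (by norm_num)
      refine h0.comp ?_
      exact tendsto_atBot_add_const_left atTop (1 : ℝ) tendsto_neg_atTop_atBot
    have h2 := h.mul_const (∑' n : ℕ, 1 / (n : ℝ) ^ 2)
    rw [zero_mul] at h2
    exact h2.eventually_lt_const (by norm_num)
  have hL : ∀ᶠ p : ℝ in atTop, Real.log p ^ 2 ≤ 0.2 * p := by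
    have h := (Real.isLittleO_pow_log_id_atTop (n := 2)).def (show (0 : ℝ) < 0.2 by norm_num)
    filter_upwards [h, eventually_ge_atTop (0 : ℝ)] with p hp h0
    simpa [abs_of_nonneg h0] using hp
  obtain ⟨P, hP⟩ := eventually_atTop.1 (hZ.and (hL.and (log_Gamma_bound.and
    (eventually_ge_atTop (1 : ℝ)))))
  refine ⟨P, fun p hpP a ha => ?_⟩
  obtain ⟨hz, hl, hg, hp1⟩ := hP p hpP.le
  have hp0 : 0 < p := by linarith
  have hlog0 : 0 ≤ Real.log p := Real.log_nonneg hp1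
  set c := p / (2 * π * Real.exp 1) with hc
  have hc0 : 0 < c := by positivity
  set x := Real.log p / (2 * p) with hx
  have hx0 : 0 ≤ x := by positivity
  have ha1 : c * (1 + x) < a - 1 := by
    have : c * (1 + x) = c + Real.log p / (4 * π * Real.exp 1) := by
      rw [hc, hx]; field_simp; ring
    rw [this]; linarith
  have ha0 : 0 < a - 1 := lt_of_le_of_lt (by positivity) ha1
  -- the last term of the sum
  have hceil : 2 ≤ ⌈a⌉₊ := by
    have : 1 < ⌈a⌉₊ := Nat.lt_ceil.2 (by push_cast; linarith)
    omega
  have hsum : (a - 1) ^ p ≤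
      ∑ r ∈ Finset.range (⌈a⌉₊ - 1), ((r : ℝ) + (a - (⌈a⌉₊ - 1 : ℕ))) ^ p := by
    obtain ⟨m, hm⟩ : ∃ m, ⌈a⌉₊ = m + 2 := ⟨⌈a⌉₊ - 2, by omega⟩
    have hb : (m : ℝ) + 1 < a := by
      have : m + 1 < ⌈a⌉₊ := by omega
      have := Nat.lt_ceil.1 this
      push_cast at this
      exact this
    have e : ⌈a⌉₊ - 1 = m + 1 := by omega
    rw [e, Finset.sum_range_succ]
    have h0 : 0 ≤ ∑ r ∈ Finset.range m, ((r : ℝ) + (a - (m + 1 : ℕ))) ^ p := by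
      refine Finset.sum_nonneg fun r _ => Real.rpow_nonneg ?_ _
      push_cast
      have : (0 : ℝ) ≤ r := Nat.cast_nonneg r
      linarith
    have e2 : (m : ℝ) + (a - (m + 1 : ℕ)) = a - 1 := by push_cast; ring
    rw [e2]
    linarith
  have hzb := hzeta_bound (a - (⌈a⌉₊ - 1 : ℕ)) p hp1
  unfold zetaH
  set Z := 1 + (2 : ℝ) ^ (1 - p) * ∑' n : ℕ, 1 / (n : ℝ) ^ 2 with hZdef
  have hZ1 : 1 ≤ Z := by
    have : 0 ≤ (2 : ℝ) ^ (1 - p) * ∑' n : ℕ, 1 / (n : ℝ) ^ 2 :=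
      mul_nonneg (by positivity) (tsum_nonneg fun n => by positivity)
    linarith
  have hZ2 : Real.log Z ≤ 0.01 := by
    have := Real.log_le_sub_one_of_pos (show 0 < Z by linarith)
    linarith
  have hG := Real.Gamma_pos_of_pos (show 0 < 1 + p by linarith)
  have key : (2 * π) ^ (-(1 + p)) * Real.Gamma (1 + p) * (2 * Z) < (a - 1) ^ p := by
    rw [← Real.log_lt_log_iff (by positivity) (by positivity), Real.log_rpow ha0,
      Real.log_mul (by positivity) (by positivity), Real.log_mul (by positivity) (by positivity),
      Real.log_mul (by positivity) (by positivity), Real.log_rpow (by positivity)]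
    have l1 : Real.log (c * (1 + x)) < Real.log (a - 1) :=
      Real.log_lt_log (by positivity) ha1
    rw [Real.log_mul (by positivity) (by positivity), hc,
      Real.log_div (by positivity) (by positivity),
      Real.log_mul (by positivity) (by positivity), Real.log_exp] at l1
    have l2 : x - x ^ 2 ≤ Real.log (1 + x) := by
      have := Real.one_sub_inv_le_log_of_pos (show 0 < 1 + x by positivity)
      refine le_trans ?_ this
      rw [le_sub_iff_add_le, ← le_sub_iff_add_le', inv_le_iff_one_le_mul₀ (by positivity)]
      nlinarith [pow_nonneg hx0 3]
    have l3 : p * x = Real.log p / 2 := by rw [hx]; field_simp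
    have l4 : p * x ^ 2 ≤ 0.05 := by
      have : p * x ^ 2 = Real.log p ^ 2 / (4 * p) := by rw [hx]; field_simp; ring
      rw [this, div_le_iff₀ (by positivity)]; linarith
    have l5 : 2 * Real.log 2 + 0.3 ≤ Real.log (2 * π) := by
      have h := Real.one_sub_inv_le_log_of_pos (show 0 < π / 2 by positivity)
      rw [Real.log_div pi_pos.ne' (by norm_num)] at h
      rw [Real.log_mul (by norm_num) pi_pos.ne']
      have : (π / 2)⁻¹ ≤ 0.7 := by
        rw [inv_le_iff_one_le_mul₀ (by positivity)]; linarith [pi_gt_three]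
      linarith
    have l6 := mul_lt_mul_of_pos_left l1 hp0
    have l7 := mul_le_mul_of_nonneg_left l2 hp0.le
    nlinarith
  linarith
end

section
/- There exists a threshold P such that for every real p > P the set Z(p) of positive real zeroes of a ↦ ζ(-p, a) is finite, and its cardinality N(p) satisfies (p−1)/(πe) − 1 < N(p) < (p−1)/(πe) + (1/2)·log p + 2πe + 2. -/
open Real HurwitzZeta

open Filter Topology

/-- The Fourier series attached to `ζ(-p, a)`. -/
noncomputable def cser (p a : ℝ) : ℝ :=
  ∑' n : ℕ, Real.cos (2 * π * n * a - π * (1 + p) / 2) / (n : ℝ) ^ (1 + p)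

lemma cser_summable {p : ℝ} (hp : 0 < p) (a : ℝ) :
    Summable fun n : ℕ => Real.cos (2 * π * n * a - π * (1 + p) / 2) / (n : ℝ) ^ (1 + p) := by
  have h : Summable fun n : ℕ => 1 / (n : ℝ) ^ (1 + p) :=
    Real.summable_one_div_nat_rpow.2 (by linarith)
  refine Summable.of_norm_bounded h fun n => ?_
  have h0 : 0 ≤ (n : ℝ) ^ (1 + p) := by positivity
  rw [norm_div, Real.norm_eq_abs, Real.norm_of_nonneg h0]
  exact div_le_div_of_nonneg_right (Real.abs_cos_le_one _) h0

lemma hzeta_eq {p : ℝ} (hp : 0 < p) (a : ℝ) : hzeta (-p) a = Q p * cser p a := by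
  unfold hzeta
  have h1 := hurwitzZeta_one_sub (a : UnitAddCircle) (s := ((1 + p : ℝ) : ℂ)) (by
      intro n h
      have : (1 + p : ℝ) = -(n : ℝ) := by exact_mod_cast h
      have : (0 : ℝ) ≤ n := by positivity
      linarith) (Or.inr (by
      intro h
      have : (1 + p : ℝ) = 1 := by exact_mod_cast h
      linarith))
  have e : ((-p : ℝ) : ℂ) = 1 - ((1 + p : ℝ) : ℂ) := by push_cast; ring
  rw [e, h1]
  have hre : 1 < (((1 + p : ℝ) : ℂ)).re := by simpa using hp
  have s1 := (hasSum_expZeta_of_one_lt_re a hre).mul_left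
    (Complex.exp (-π * Complex.I * ((1 + p : ℝ) : ℂ) / 2))
  have s2 := (hasSum_expZeta_of_one_lt_re (-a) hre).mul_left
    (Complex.exp (π * Complex.I * ((1 + p : ℝ) : ℂ) / 2))
  have s3 := s1.add s2
  have s4 : HasSum (fun n : ℕ => ((2 * (Real.cos (2 * π * n * a - π * (1 + p) / 2) /
      (n : ℝ) ^ (1 + p)) : ℝ) : ℂ)) ((2 * cser p a : ℝ) : ℂ) := by
    rw [Complex.hasSum_ofReal]
    exact (cser_summable hp a).hasSum.mul_left 2
  have s5 := s3.unique (s4.congr_fun ?_)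
  · have e2 : ((-a : ℝ) : UnitAddCircle) = -(a : UnitAddCircle) := by simp
    rw [e2] at s5
    rw [s5, Complex.Gamma_ofReal]
    have e3 : (2 * (π : ℂ)) ^ (-((1 + p : ℝ) : ℂ)) = (((2 * π) ^ (-(1 + p)) : ℝ) : ℂ) := by
      rw [Complex.ofReal_cpow (by positivity)]; push_cast; rfl
    rw [e3, ← Complex.ofReal_mul, ← Complex.ofReal_mul, Complex.ofReal_re, Q,
      Real.rpow_neg (by positivity)]
    ring
  · intro n
    have e4 : ((n : ℂ)) ^ ((1 + p : ℝ) : ℂ) = (((n : ℝ) ^ (1 + p) : ℝ) : ℂ) := by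
      rw [Complex.ofReal_cpow (by positivity)]; push_cast; rfl
    rw [e4]
    push_cast
    rw [mul_div_assoc', mul_div_assoc', mul_div_assoc', ← add_div, ← Complex.exp_add,
      ← Complex.exp_add, Complex.two_cos]
    congr 2
    · congr 1; ring
    · congr 1; ring

lemma cser_add_one (p a : ℝ) : cser p (a + 1) = cser p a := by
  unfold cser
  congr 1
  ext n
  congr 1
  rw [← Real.cos_add_nat_mul_two_pi (2 * π * n * a - π * (1 + p) / 2) n]
  congr 1; ring

lemma cser_sub_nat (p a : ℝ) (n : ℕ) : cser p (a - n) = cser p a := by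
  induction n with
  | zero => simp
  | succ k ih => rw [← ih, ← cser_add_one]; congr 1; push_cast; ring

lemma cser_hasDerivAt {p : ℝ} (hp : 1 < p) (a : ℝ) :
    HasDerivAt (cser p) (2 * π * cser (p - 1) a) a := by
  have hu : Summable fun n : ℕ => 2 * π * (1 / (n : ℝ) ^ p) :=
    (Real.summable_one_div_nat_rpow.2 hp).mul_left _
  have key := hasDerivAt_tsum (𝕜 := ℝ) (F := ℝ) (u := fun n : ℕ => 2 * π * (1 / (n : ℝ) ^ p))
    (g := fun n a => Real.cos (2 * π * n * a - π * (1 + p) / 2) / (n : ℝ) ^ (1 + p))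
    (g' := fun n a => 2 * π * (Real.cos (2 * π * n * a - π * (1 + (p - 1)) / 2) /
        (n : ℝ) ^ (1 + (p - 1)))) (y₀ := a) hu ?_ ?_ (cser_summable (by linarith) a) a
  · rw [tsum_mul_left] at key
    exact key
  · intro n y
    have h1 : HasDerivAt (fun y : ℝ => 2 * π * n * y - π * (1 + p) / 2) (2 * π * n) y := by
      simpa using ((hasDerivAt_id y).const_mul (2 * π * n)).sub_const (π * (1 + p) / 2)
    have h2 := h1.cos.div_const ((n : ℝ) ^ (1 + p))
    refine h2.congr_deriv ?_
    symm
    have e : π * (1 + (p - 1)) / 2 = π * (1 + p) / 2 - π / 2 := by ring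
    have e2 : 2 * π * n * y - (π * (1 + p) / 2 - π / 2) =
      (2 * π * n * y - π * (1 + p) / 2) + π / 2 := by ring
    rw [e, e2, Real.cos_add_pi_div_two, add_sub_cancel]
    rcases Nat.eq_zero_or_pos n with h | h
    · subst h
      simp [Real.zero_rpow (by linarith : p ≠ 0)]
    · have hn : (0 : ℝ) < n := by exact_mod_cast h
      rw [Real.rpow_add hn, Real.rpow_one]
      field_simp
  · intro n y
    have h0 : 0 ≤ (n : ℝ) ^ p := by positivity
    rw [add_sub_cancel, norm_mul, norm_div, Real.norm_of_nonneg h0, Real.norm_eq_abs,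
      Real.norm_eq_abs, abs_of_pos (by positivity : 0 < 2 * π)]
    gcongr
    exact Real.abs_cos_le_one _

/-- Truncated power. -/
noncomputable def tpow (p x : ℝ) : ℝ := (max x 0) ^ p

lemma tpow_of_nonneg (p : ℝ) {x : ℝ} (hx : 0 ≤ x) : tpow p x = x ^ p := by
  simp [tpow, hx]

lemma tpow_of_nonpos {p : ℝ} (hp : 0 < p) {x : ℝ} (hx : x ≤ 0) : tpow p x = 0 := by
  simp [tpow, hx, Real.zero_rpow hp.ne']

lemma tpow_nonneg (p x : ℝ) : 0 ≤ tpow p x := by unfold tpow; positivity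

lemma tpow_hasDerivAt {p : ℝ} (hp : 1 < p) (x : ℝ) :
    HasDerivAt (tpow p) (p * tpow (p - 1) x) x := by
  rcases lt_trichotomy x 0 with h | h | h
  · rw [tpow_of_nonpos (by linarith) h.le, mul_zero]
    refine (hasDerivAt_const x (0 : ℝ)).congr_of_eventuallyEq ?_
    filter_upwards [Iio_mem_nhds h] with y hy
    exact tpow_of_nonpos (by linarith) (le_of_lt hy)
  · subst h
    have h1 : HasDerivWithinAt (tpow p) (p * tpow (p - 1) 0) (Set.Iic 0) 0 := by
      rw [tpow_of_nonpos (by linarith) le_rfl, mul_zero]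
      refine (hasDerivWithinAt_const (0 : ℝ) _ (0 : ℝ)).congr ?_ ?_
      · intro y hy; exact tpow_of_nonpos (by linarith) hy
      · exact tpow_of_nonpos (by linarith) le_rfl
    have h2 : HasDerivWithinAt (tpow p) (p * tpow (p - 1) 0) (Set.Ici 0) 0 := by
      rw [tpow_of_nonneg _ le_rfl]
      refine (Real.hasDerivAt_rpow_const (Or.inr hp.le)).hasDerivWithinAt.congr ?_ ?_
      · intro y hy; exact tpow_of_nonneg _ hy
      · exact tpow_of_nonneg _ le_rfl
    have := h1.union h2
    rwa [Set.Iic_union_Ici, hasDerivWithinAt_univ] at this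
  · rw [tpow_of_nonneg _ h.le]
    refine (Real.hasDerivAt_rpow_const (Or.inr hp.le)).congr_of_eventuallyEq ?_
    filter_upwards [Ioi_mem_nhds h] with y hy
    exact tpow_of_nonneg _ (le_of_lt hy)

lemma zetaH_eq {p a : ℝ} (hp : 0 < p) (ha : 0 < a) (N : ℕ) (hN : a ≤ N + 1) :
    zetaH p a = Q p * cser p a - ∑ r ∈ Finset.range N, tpow p (a - 1 - r) := by
  unfold zetaH
  rw [hzeta_eq hp, cser_sub_nat]
  congr 1
  have hc : 0 < ⌈a⌉₊ := Nat.ceil_pos.2 ha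
  obtain ⟨m, hm⟩ : ∃ m, ⌈a⌉₊ = m + 1 := ⟨⌈a⌉₊ - 1, by omega⟩
  have hmN : m ≤ N := by
    have : ⌈a⌉₊ ≤ N + 1 := Nat.ceil_le.2 (by exact_mod_cast hN)
    omega
  have hle : a ≤ m + 1 := by
    have := Nat.le_ceil a; rw [hm] at this; exact_mod_cast this
  have hlt : (m : ℝ) < a := by
    have := Nat.ceil_lt_add_one ha.le; rw [hm] at this; push_cast at this; linarith
  rw [hm, Nat.add_sub_cancel, ← Finset.sum_range_reflect]
  rw [← Finset.sum_subset (Finset.range_subset_range.2 hmN)]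
  · apply Finset.sum_congr rfl
    intro r hr
    have hr' : r < m := Finset.mem_range.1 hr
    have hr2 : ((m - 1 - r : ℕ) : ℝ) = m - 1 - r := by
      rw [Nat.cast_sub (by omega), Nat.cast_sub (by omega)]; simp
    have : (r : ℝ) + 1 ≤ m := by exact_mod_cast hr'
    rw [hr2, tpow_of_nonneg _ (by linarith)]
    congr 1; ring
  · intro r _ hr
    have hr' : m ≤ r := by simpa using hr
    have : (m : ℝ) ≤ r := by exact_mod_cast hr'
    exact tpow_of_nonpos hp (by linarith)

lemma Q_pos {p : ℝ} (hp : 0 < p) : 0 < Q p := by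
  unfold Q
  have := Real.Gamma_pos_of_pos (by linarith : 0 < 1 + p)
  positivity

lemma Q_rec {p : ℝ} (hp : 1 < p) : Q p * (2 * π) = p * Q (p - 1) := by
  unfold Q
  rw [add_comm 1 p, Real.Gamma_add_one (by linarith), Real.rpow_add (by positivity) p 1,
    Real.rpow_one, show 1 + (p - 1) = p by ring]
  field_simp

lemma zetaH_hasDerivAt {p a : ℝ} (hp : 1 < p) (ha : 0 < a) :
    HasDerivAt (zetaH p) (p * zetaH (p - 1) a) a := by
  obtain ⟨N, hN⟩ := exists_nat_gt a
  rw [zetaH_eq (by linarith) ha N (by linarith)]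
  have h1 : HasDerivAt (fun a => Q p * cser p a - ∑ r ∈ Finset.range N, tpow p (a - 1 - r))
      (Q p * (2 * π * cser (p - 1) a) - ∑ r ∈ Finset.range N, p * tpow (p - 1) (a - 1 - r)) a := by
    refine ((cser_hasDerivAt hp a).const_mul _).sub (HasDerivAt.fun_sum fun r _ => ?_)
    have h := (tpow_hasDerivAt hp (a - 1 - r)).comp a
      (((hasDerivAt_id a).sub_const 1).sub_const (r : ℝ))
    rw [mul_one] at h
    exact h
  have e : p * (Q (p - 1) * cser (p - 1) a - ∑ r ∈ Finset.range N, tpow (p - 1) (a - 1 - r)) =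
      (Q p * (2 * π * cser (p - 1) a) - ∑ r ∈ Finset.range N, p * tpow (p - 1) (a - 1 - r)) := by
    rw [← Finset.mul_sum, ← mul_assoc (Q p), Q_rec hp]; ring
  rw [e]
  refine h1.congr_of_eventuallyEq ?_
  filter_upwards [Ioi_mem_nhds ha, Iio_mem_nhds hN] with y hy hy2
  exact zetaH_eq (by linarith) hy N (by have : y < N := hy2; linarith)

lemma cser_approx {p : ℝ} (hp : 3 ≤ p) (a : ℝ) :
    |cser p a - Real.cos (2 * π * a - π * (1 + p) / 2)| ≤ 1 / 4 := by
  have hs := cser_summable (by linarith : 0 < p) a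
  have h := hs.sum_add_tsum_nat_add 2
  have e0 : (0 : ℝ) ^ (1 + p) = 0 := Real.zero_rpow (by linarith)
  simp only [Finset.sum_range_succ, Finset.sum_range_zero, Nat.cast_zero, Nat.cast_one, e0, div_zero,
    Real.one_rpow, div_one, zero_add, mul_one] at h
  have e : cser p a - Real.cos (2 * π * a - π * (1 + p) / 2) =
      ∑' n : ℕ, Real.cos (2 * π * (n + 2 : ℕ) * a - π * (1 + p) / 2) / ((n + 2 : ℕ) : ℝ) ^ (1 + p) := by
    unfold cser
    rw [← h]; ring
  rw [e]
  have hz := hasSum_zeta_two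
  have hz2 := (hasSum_nat_add_iff' 2).2 hz
  simp only [Finset.sum_range_succ, Finset.sum_range_zero, Nat.cast_zero, Nat.cast_one] at hz2
  have hz3 := hz2.mul_left (1 / 4)
  refine le_trans (tsum_of_norm_bounded (f := fun n : ℕ =>
    Real.cos (2 * π * (n + 2 : ℕ) * a - π * (1 + p) / 2) / ((n + 2 : ℕ) : ℝ) ^ (1 + p)) hz3 ?_) ?_
  · intro n
    have h2 : (2 : ℝ) ≤ ((n + 2 : ℕ) : ℝ) := by push_cast; linarith [(Nat.cast_nonneg n : (0 : ℝ) ≤ n)]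
    generalize ((n + 2 : ℕ) : ℝ) = m at h2 ⊢
    have h0 : 0 < m ^ (1 + p) := by positivity
    rw [norm_div, Real.norm_eq_abs, Real.norm_of_nonneg h0.le]
    have h4 : m ^ (4 : ℝ) ≤ m ^ (1 + p) := Real.rpow_le_rpow_of_exponent_le (by linarith) (by linarith)
    have h5 : m ^ (4 : ℝ) = m ^ 4 := by exact_mod_cast Real.rpow_natCast m 4
    rw [h5] at h4
    have h6 : 4 * m ^ 2 ≤ m ^ 4 := by
      have : m ^ 4 = m ^ 2 * m ^ 2 := by ring
      have hm2 : 4 ≤ m ^ 2 := by nlinarith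
      nlinarith
    have h7 : 1 / 4 * (1 / m ^ 2) = 1 / (4 * m ^ 2) := by field_simp
    rw [h7]
    have h8 : 0 < 4 * m ^ 2 := by positivity
    exact div_le_div₀ (by norm_num) (Real.abs_cos_le_one _) h8 (by linarith)
  · have := Real.pi_lt_d2
    have := Real.pi_pos
    have : π ^ 2 < 10 := by nlinarith
    norm_num
    linarith

lemma tpow_sum_le {p a B : ℝ} (hp : 0 < p) (hB : 0 < B) (hBp : B ≤ p) (ha : a ≤ B + 1) (N : ℕ) :
    ∑ r ∈ Finset.range N, tpow p (a - 1 - r) ≤ 2 * B ^ p := by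
  have h1 : ∀ r ∈ Finset.range N, tpow p (a - 1 - r) ≤ B ^ p * (1 / 2) ^ r := by
    intro r _
    rcases le_or_gt (a - 1 - r) 0 with h | h
    · rw [tpow_of_nonpos hp h]; positivity
    · rw [tpow_of_nonneg _ h.le]
      have hr : (0 : ℝ) ≤ r := Nat.cast_nonneg r
      have h2 : a - 1 - r ≤ B * Real.exp (-(r / B)) := by
        have := Real.add_one_le_exp (-((r : ℝ) / B))
        have h3 : B * (-((r : ℝ) / B) + 1) = B - r := by field_simp; ring
        have := mul_le_mul_of_nonneg_left this hB.le
        linarith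
      calc (a - 1 - r) ^ p ≤ (B * Real.exp (-(r / B))) ^ p := Real.rpow_le_rpow h.le h2 hp.le
        _ = B ^ p * Real.exp (-(r / B) * p) := by
            rw [Real.mul_rpow hB.le (Real.exp_pos _).le, ← Real.exp_mul]
        _ ≤ B ^ p * (1 / 2) ^ r := by
            gcongr
            have h5 : (r : ℝ) ≤ r / B * p := by
              rw [div_mul_eq_mul_div, le_div_iff₀ hB]; gcongr
            have h6 : Real.exp (-(r / B) * p) ≤ Real.exp (r * (-1)) :=
              Real.exp_le_exp.2 (by linarith)
            refine h6.trans ?_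
            rw [Real.exp_nat_mul]
            gcongr
            rw [Real.exp_neg, one_div]
            apply inv_anti₀ (by norm_num)
            linarith [Real.add_one_le_exp (1 : ℝ)]
  refine (Finset.sum_le_sum h1).trans ?_
  rw [← Finset.mul_sum, mul_comm]
  gcongr
  exact sum_geometric_two_le N

lemma zetaH_approx {p a B : ℝ} (hp : 3 ≤ p) (hB : 0 < B) (hBp : B ≤ p) (ha : 0 < a)
    (ha' : a ≤ B + 1) (hQ : 8 * B ^ p ≤ Q p) :
    |zetaH p a - Q p * Real.cos (π * (2 * a - (p + 1) / 2))| ≤ Q p / 2 := by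
  obtain ⟨N, hN⟩ := exists_nat_gt a
  rw [zetaH_eq (by linarith) ha N (by linarith)]
  have h1 := tpow_sum_le (by linarith : 0 < p) hB hBp ha' N
  have h2 : 0 ≤ ∑ r ∈ Finset.range N, tpow p (a - 1 - r) :=
    Finset.sum_nonneg fun r _ => tpow_nonneg _ _
  have h3 := cser_approx hp a
  have e : 2 * π * a - π * (1 + p) / 2 = π * (2 * a - (p + 1) / 2) := by ring
  rw [e] at h3
  have hQp := Q_pos (by linarith : 0 < p)
  rw [abs_le] at h3 ⊢
  constructor <;> nlinarith [h3.1, h3.2]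

lemma zetaH_neg {q a B : ℝ} (hq : 3 ≤ q) (hB : 0 < B) (hBQ : B ^ q = 2 * Q q) (ha : B + 1 < a) :
    zetaH q a < 0 := by
  obtain ⟨N, hN⟩ := exists_nat_gt a
  rw [zetaH_eq (by linarith) (by linarith) N (by linarith)]
  have hN0 : 0 < N := by
    rcases Nat.eq_zero_or_pos N with h | h
    · subst h; simp at hN; linarith
    · exact h
  have h2 : tpow q (a - 1 - (0 : ℕ)) ≤ ∑ r ∈ Finset.range N, tpow q (a - 1 - r) :=
    Finset.single_le_sum (f := fun r : ℕ => tpow q (a - 1 - r)) (fun r _ => tpow_nonneg _ _)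
      (Finset.mem_range.2 hN0)
  rw [tpow_of_nonneg _ (by push_cast; linarith)] at h2
  have h4 : B ^ q < (a - 1 - (0 : ℕ)) ^ q :=
    Real.rpow_lt_rpow hB.le (by push_cast; linarith) (by linarith)
  have h3 := cser_approx hq a
  have hc := Real.cos_le_one (2 * π * a - π * (1 + q) / 2)
  have hQp := Q_pos (by linarith : 0 < q)
  rw [abs_le] at h3
  nlinarith [h3.1, h3.2]

lemma Q_growth {q B : ℝ} (hq : 3 ≤ q) (hB : 0 < B) (hBQ : B ^ q = 2 * Q q) (hB2 : 4 * π * B ≤ q)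
    (k : ℕ) : 2 ^ k * B ^ (q + k) ≤ 2 * Q (q + k) := by
  induction k with
  | zero => simp [hBQ]
  | succ k ih =>
    have hk : (0 : ℝ) ≤ k := Nat.cast_nonneg k
    have hr := Q_rec (p := q + k + 1) (by linarith)
    rw [add_sub_cancel_right] at hr
    push_cast
    rw [← add_assoc, Real.rpow_add hB, Real.rpow_one, pow_succ]
    have hQp := Q_pos (by linarith : 0 < q + k)
    have h1 : 2 ^ k * 2 * (B ^ (q + k) * B) ≤ 4 * B * Q (q + k) := by nlinarith
    refine h1.trans ?_
    have h2 : 4 * π * B * Q (q + k) ≤ (q + k + 1) * Q (q + k) := by gcongr; linarith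
    rw [← hr] at h2
    have : π * (4 * B * Q (q + k)) ≤ π * (2 * Q (q + k + 1)) := by nlinarith
    exact le_of_mul_le_mul_left this Real.pi_pos

lemma no_chain {q B : ℝ} (hq : 3 ≤ q) (hB : 0 < B) (hBQ : B ^ q = 2 * Q q) (k : ℕ) :
    ¬ ∃ z : Fin (k + 1) → ℝ, StrictMono z ∧ ∀ i, B + 1 < z i ∧ zetaH (q + k) (z i) = 0 := by
  induction k with
  | zero =>
    rintro ⟨z, -, hz⟩
    have := hz 0
    have h2 := zetaH_neg hq hB hBQ this.1
    simp at this
    linarith [this.2]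
  | succ k ih =>
    rintro ⟨z, hm, hz⟩
    apply ih
    have hk : (0 : ℝ) ≤ k := Nat.cast_nonneg k
    have : ∀ i : Fin (k + 1), ∃ c, z i.castSucc < c ∧ c < z i.succ ∧ zetaH (q + k) c = 0 := by
      intro i
      have hder : ∀ x, B + 1 < x →
          HasDerivAt (zetaH (q + (k + 1 : ℕ))) ((q + (k + 1 : ℕ)) * zetaH (q + (k + 1 : ℕ) - 1) x) x :=
        fun x hx => zetaH_hasDerivAt (by push_cast; linarith) (by linarith)
      obtain ⟨c, hc, h0⟩ := exists_hasDerivAt_eq_zero (hm (Fin.castSucc_lt_succ (i := i)))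
        (fun x hx => (hder x ((hz i.castSucc).1.trans_le hx.1)).continuousAt.continuousWithinAt)
        ((hz i.castSucc).2.trans (hz i.succ).2.symm)
        (fun x hx => hder x ((hz i.castSucc).1.trans hx.1))
      refine ⟨c, hc.1, hc.2, ?_⟩
      have e : q + ((k + 1 : ℕ) : ℝ) - 1 = q + k := by push_cast; ring
      rw [e] at h0
      rcases mul_eq_zero.1 h0 with h | h
      · push_cast at h; linarith
      · exact h
    choose c h1 h2 h3 using this
    refine ⟨c, ?_, fun i => ⟨(hz _).1.trans (h1 i), h3 i⟩⟩
    intro i j hij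
    have : i.succ ≤ j.castSucc := by
      rw [Fin.le_def]; simp; exact hij
    exact ((h2 i).trans_le (hm.monotone this)).trans (h1 j)

lemma ncard_le_of_no_chain {S : Set ℝ} {k : ℕ}
    (h : ¬ ∃ z : Fin (k + 1) → ℝ, StrictMono z ∧ ∀ i, z i ∈ S) : S.Finite ∧ S.ncard ≤ k := by
  have key : ¬ ∃ t : Finset ℝ, (t : Set ℝ) ⊆ S ∧ t.card = k + 1 := by
    rintro ⟨t, ht, hc⟩
    exact h ⟨t.orderEmbOfFin hc, (t.orderEmbOfFin hc).strictMono,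
      fun i => ht (Finset.orderEmbOfFin_mem t hc i)⟩
  have hf : S.Finite := by
    by_contra hinf
    exact key (Set.Infinite.exists_subset_card_eq hinf (k + 1))
  refine ⟨hf, ?_⟩
  by_contra hlt
  rw [Set.ncard_eq_toFinset_card S hf] at hlt
  obtain ⟨t, ht, hc⟩ := Finset.exists_subset_card_eq (show k + 1 ≤ hf.toFinset.card by omega)
  refine key ⟨t, ?_, hc⟩
  intro x hx
  simpa using ht hx

lemma neg_one_zpow_cases (j : ℤ) : (-1 : ℝ) ^ j = 1 ∨ (-1 : ℝ) ^ j = -1 := by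
  rcases Int.even_or_odd j with h | h
  · exact Or.inl h.neg_one_zpow
  · exact Or.inr h.neg_one_zpow

lemma trig_aux {u v w : ℝ} (huv : u < v) (hvw : v < w) (hf : ⌊u⌋ = ⌊w⌋)
    (hu : |Real.cos (π * u)| ≤ 1 / 2) (hw : |Real.cos (π * w)| ≤ 1 / 2)
    (hv : |Real.sin (π * v)| ≤ 1 / 2) : False := by
  set j := ⌊u⌋ with hj
  have h1 : (j : ℝ) ≤ u := Int.floor_le u
  have h2 : w < j + 1 := by rw [hf]; exact Int.lt_floor_add_one w
  have hpi := Real.pi_pos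
  have hsin : ∀ x : ℝ, Real.sin (π * x) ^ 2 = Real.sin (π * (x - j)) ^ 2 := by
    intro x
    have : π * (x - j) = π * x - j * π := by ring
    rw [this, Real.sin_sub_int_mul_pi, mul_pow]
    rcases neg_one_zpow_cases j with h | h <;> rw [h] <;> norm_num
  have hmem : ∀ x : ℝ, j ≤ x → x ≤ j + 1 → π * (x - j) ∈ Set.Icc 0 π := by
    intro x hx hx'
    constructor
    · have : 0 ≤ x - j := by linarith
      positivity
    · nlinarith
  have hpos : ∀ x : ℝ, j ≤ x → x ≤ j + 1 → 0 ≤ Real.sin (π * (x - j)) := fun x hx hx' =>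
    Real.sin_nonneg_of_mem_Icc (hmem x hx hx')
  have hbig : ∀ x : ℝ, j ≤ x → x ≤ j + 1 → |Real.cos (π * x)| ≤ 1 / 2 →
      1 / 2 < Real.sin (π * (x - j)) := by
    intro x hx hx' hc
    have := hsin x
    have h0 := hpos x hx hx'
    have hs := Real.sin_sq_add_cos_sq (π * x)
    rw [abs_le] at hc
    nlinarith [hc.1, hc.2]
  have hconc := strictConcaveOn_sin_Icc.concaveOn.min_le_of_mem_Icc
    (hmem u h1 (by linarith)) (hmem w (by linarith) h2.le) (z := π * (v - j))
    ⟨by gcongr, by gcongr⟩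
  have hb := (lt_min (hbig u h1 (by linarith) hu) (hbig w (by linarith) h2.le hw)).trans_le hconc
  have := hsin v
  rw [abs_le] at hv
  nlinarith [hv.1, hv.2]

lemma first_region {q B : ℝ} (hq : 3 ≤ q) (hB : 0 < B) (hBQ : B ^ q = 2 * Q q)
    (hB2 : 4 * π * B ≤ q) :
    {a : ℝ | 0 < a ∧ a ≤ B + 1 ∧ zetaH (q + 5) a = 0}.Finite ∧
    ({a : ℝ | 0 < a ∧ a ≤ B + 1 ∧ zetaH (q + 5) a = 0}.ncard : ℝ) ≤ 2 * B + 4 ∧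
    ({a : ℝ | 0 < a ∧ a ≤ B + 1 ∧ zetaH (q + 5) a = 0}.Finite →
      2 * B ≤ ({a : ℝ | 0 < a ∧ a ≤ B + 1 ∧ zetaH (q + 5) a = 0}.ncard : ℝ)) := by
  set S := {a : ℝ | 0 < a ∧ a ≤ B + 1 ∧ zetaH (q + 5) a = 0} with hS
  have hpi := Real.pi_gt_three
  have hBq : B ≤ q := by nlinarith
  have g4 := Q_growth hq hB hBQ hB2 4
  have g5 := Q_growth hq hB hBQ hB2 5
  push_cast at g4 g5
  have A4 : ∀ a, 0 < a → a ≤ B + 1 →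
      |zetaH (q + 4) a - Q (q + 4) * Real.cos (π * (2 * a - (q + 4 + 1) / 2))| ≤ Q (q + 4) / 2 :=
    fun a h h' => zetaH_approx (by linarith) hB (by linarith) h h' (by linarith)
  have A5 : ∀ a, 0 < a → a ≤ B + 1 →
      |zetaH (q + 5) a - Q (q + 5) * Real.cos (π * (2 * a - (q + 5 + 1) / 2))| ≤ Q (q + 5) / 2 :=
    fun a h h' => zetaH_approx (by linarith) hB (by linarith) h h' (by
      have : 0 ≤ B ^ (q + 5) := by positivity
      linarith)
  have Q4 := Q_pos (by linarith : 0 < q + 4)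
  have Q5 := Q_pos (by linarith : 0 < q + 5)
  have hder : ∀ x, 0 < x → HasDerivAt (zetaH (q + 5)) ((q + 5) * zetaH (q + 5 - 1) x) x :=
    fun x hx => zetaH_hasDerivAt (by linarith) hx
  have hzero : ∀ {a Q c : ℝ}, 0 < Q → a = 0 → |a - Q * c| ≤ Q / 2 → |c| ≤ 1 / 2 := by
    intro a Q c hQ ha h
    rw [ha, zero_sub, abs_neg, abs_mul, abs_of_pos hQ] at h
    by_contra hc
    push Not at hc
    nlinarith
  set x : ℝ := -(q + 5 + 1) / 2 with hx
  set y : ℝ := 2 * (B + 1) + x with hy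
  have hu : ∀ a : ℝ, 2 * a - (q + 5 + 1) / 2 = 2 * a + x := by intro a; rw [hx]; ring
  simp only [hu] at A5
  have hmaps : ∀ a ∈ S, ⌊2 * a + x⌋ ∈ (Finset.Icc ⌊x⌋ ⌊y⌋ : Set ℤ) := by
    intro a ha
    rw [Finset.mem_coe, Finset.mem_Icc]
    exact ⟨Int.floor_le_floor (by linarith [ha.1]), Int.floor_le_floor (by linarith [ha.2.1])⟩
  have hlt : ∀ a ∈ S, ∀ b ∈ S, ⌊2 * a + x⌋ = ⌊2 * b + x⌋ → ¬ a < b := by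
    intro a ha b hb hab hlt
    obtain ⟨c, hc, h0⟩ := exists_hasDerivAt_eq_zero hlt
      (fun t ht => (hder t (ha.1.trans_le ht.1)).continuousAt.continuousWithinAt)
      (ha.2.2.trans hb.2.2.symm) (fun t ht => hder t (ha.1.trans ht.1))
    have h0' : zetaH (q + 4) c = 0 := by
      rcases mul_eq_zero.1 h0 with h | h
      · linarith
      · rw [← h]; congr 1; ring
    have hcc := hzero Q4 h0' (A4 c (ha.1.trans hc.1) (hc.2.le.trans hb.2.1))
    have e : π * (2 * c - (q + 4 + 1) / 2) = π * (2 * c + x) + π / 2 := by rw [hx]; ring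
    rw [e, Real.cos_add_pi_div_two, abs_neg] at hcc
    exact trig_aux (by linarith [hc.1] : 2 * a + x < 2 * c + x) (by linarith [hc.2]) hab
      (hzero Q5 ha.2.2 (A5 a ha.1 ha.2.1)) (hzero Q5 hb.2.2 (A5 b hb.1 hb.2.1)) hcc
  have hinj : Set.InjOn (fun a : ℝ => ⌊2 * a + x⌋) S := by
    intro a ha b hb hab
    exact le_antisymm (not_lt.1 (hlt b hb a ha hab.symm)) (not_lt.1 (hlt a ha b hb hab))
  have hfl1 := Int.lt_floor_add_one x
  have hfl2 := Int.floor_le y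
  have hfl3 := Int.floor_le x
  have hfl4 := Int.lt_floor_add_one y
  refine ⟨Set.Finite.of_injOn hmaps hinj (Finset.finite_toSet _), ?_, ?_⟩
  · have h := Set.ncard_le_ncard_of_injOn _ hmaps hinj (Finset.finite_toSet _)
    rw [Set.ncard_coe_finset, Int.card_Icc] at h
    have hxy : ⌊x⌋ ≤ ⌊y⌋ := Int.floor_le_floor (by linarith)
    have h' : (S.ncard : ℤ) ≤ ⌊y⌋ + 1 - ⌊x⌋ := by omega
    have hreal : (S.ncard : ℝ) ≤ ⌊y⌋ + 1 - ⌊x⌋ := by exact_mod_cast h'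
    linarith
  · intro hfin
    have hex : ∀ j ∈ (Finset.Ico (⌊x⌋ + 1) ⌊y⌋ : Set ℤ), ∃ c ∈ S, ⌊2 * c + x⌋ = j := by
      intro j hj
      rw [Finset.mem_coe, Finset.mem_Ico] at hj
      have hj1 : (⌊x⌋ : ℝ) + 1 ≤ j := by exact_mod_cast hj.1
      have hj2 : (j : ℝ) + 1 ≤ ⌊y⌋ := by exact_mod_cast hj.2
      have ha0 : 0 < (j - x) / 2 := by linarith
      have hb0 : (j + 1 - x) / 2 ≤ B + 1 := by linarith
      have hab : (j - x) / 2 < (j + 1 - x) / 2 := by linarith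
      have ha1 := A5 _ ha0 (by linarith)
      have hb1 := A5 _ (by linarith : 0 < (j + 1 - x) / 2) hb0
      have ea : π * (2 * ((j - x) / 2) + x) = j * π := by ring
      have eb : π * (2 * ((j + 1 - x) / 2) + x) = j * π + π := by ring
      rw [ea] at ha1
      rw [eb, Real.cos_add_pi] at hb1
      have hcont : ContinuousOn (zetaH (q + 5)) (Set.Icc ((j - x) / 2) ((j + 1 - x) / 2)) :=
        fun t ht => (hder t (ha0.trans_le ht.1)).continuousAt.continuousWithinAt
      have hc2 : Real.cos (j * π) = 1 ∨ Real.cos (j * π) = -1 := by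
        rw [Real.cos_int_mul_pi]
        exact neg_one_zpow_cases j
      rw [abs_le] at ha1 hb1
      have : ∃ c ∈ Set.Ioo ((j - x) / 2) ((j + 1 - x) / 2), zetaH (q + 5) c = 0 := by
        rcases hc2 with h | h <;> rw [h] at ha1 hb1
        · exact intermediate_value_Ioo' hab.le hcont ⟨by linarith [hb1.2], by linarith [ha1.1]⟩
        · exact intermediate_value_Ioo hab.le hcont ⟨by linarith [ha1.2], by linarith [hb1.1]⟩
      obtain ⟨c, hc, hc0⟩ := this
      refine ⟨c, ⟨by linarith [hc.1], by linarith [hc.2], hc0⟩, ?_⟩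
      rw [Int.floor_eq_iff]
      constructor <;> linarith [hc.1, hc.2]
    have hsub : (Finset.Ico (⌊x⌋ + 1) ⌊y⌋ : Set ℤ) ⊆ Set.image (fun a : ℝ => ⌊2 * a + x⌋) S := by
      intro j hj
      obtain ⟨c, hc, h⟩ := hex j hj
      exact ⟨c, hc, h⟩
    have h1 := Set.ncard_le_ncard hsub (hfin.image _)
    have h2 := Set.ncard_image_le (f := fun a : ℝ => ⌊2 * a + x⌋) hfin
    rw [Set.ncard_coe_finset, Int.card_Ico] at h1
    have h' : ⌊y⌋ - (⌊x⌋ + 1) ≤ (S.ncard : ℤ) := by omega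
    have hreal : (⌊y⌋ : ℝ) - (⌊x⌋ + 1) ≤ S.ncard := by exact_mod_cast h'
    linarith

lemma count_bounds {q B : ℝ} (hq : 3 ≤ q) (hB : 0 < B) (hBQ : B ^ q = 2 * Q q)
    (hB2 : 4 * π * B ≤ q) :
    {a : ℝ | 0 < a ∧ zetaH (q + 5) a = 0}.Finite ∧
    2 * B ≤ ({a : ℝ | 0 < a ∧ zetaH (q + 5) a = 0}.ncard : ℝ) ∧
    ({a : ℝ | 0 < a ∧ zetaH (q + 5) a = 0}.ncard : ℝ) ≤ 2 * B + 9 := by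
  obtain ⟨f1, u1, l1⟩ := first_region hq hB hBQ hB2
  obtain ⟨f2, u2⟩ := ncard_le_of_no_chain (S := {a : ℝ | B + 1 < a ∧ zetaH (q + (5 : ℕ)) a = 0})
    (no_chain hq hB hBQ 5)
  push_cast at f2 u2
  have e : {a : ℝ | 0 < a ∧ zetaH (q + 5) a = 0} =
      {a : ℝ | 0 < a ∧ a ≤ B + 1 ∧ zetaH (q + 5) a = 0} ∪
      {a : ℝ | B + 1 < a ∧ zetaH (q + 5) a = 0} := by
    ext a
    simp only [Set.mem_ofPred_eq, Set.mem_union]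
    constructor
    · rintro ⟨h, h'⟩
      rcases le_or_gt a (B + 1) with h2 | h2
      · exact Or.inl ⟨h, h2, h'⟩
      · exact Or.inr ⟨h2, h'⟩
    · rintro (⟨h, -, h'⟩ | ⟨h, h'⟩)
      · exact ⟨h, h'⟩
      · exact ⟨by linarith, h'⟩
  rw [e]
  refine ⟨f1.union f2, ?_, ?_⟩
  · refine (l1 f1).trans ?_
    exact_mod_cast Set.ncard_le_ncard Set.subset_union_left (f1.union f2)
  · have h := Set.ncard_union_le {a : ℝ | 0 < a ∧ a ≤ B + 1 ∧ zetaH (q + 5) a = 0}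
      {a : ℝ | B + 1 < a ∧ zetaH (q + 5) a = 0}
    have h' : (({a : ℝ | 0 < a ∧ a ≤ B + 1 ∧ zetaH (q + 5) a = 0} ∪
      {a : ℝ | B + 1 < a ∧ zetaH (q + 5) a = 0}).ncard : ℝ) ≤
      ({a : ℝ | 0 < a ∧ a ≤ B + 1 ∧ zetaH (q + 5) a = 0}.ncard : ℝ) +
      ({a : ℝ | B + 1 < a ∧ zetaH (q + 5) a = 0}.ncard : ℝ) := by exact_mod_cast h
    have u2' : ({a : ℝ | B + 1 < a ∧ zetaH (q + 5) a = 0}.ncard : ℝ) ≤ 5 := by exact_mod_cast u2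
    linarith

lemma logGamma_feq {y : ℝ} (hy : 0 < y) :
    (Real.log ∘ Real.Gamma) (y + 1) = (Real.log ∘ Real.Gamma) y + Real.log y := by
  simp only [Function.comp_apply]
  rw [Real.Gamma_add_one hy.ne', Real.log_mul hy.ne' (Real.Gamma_pos_of_pos hy).ne', add_comm]

lemma log_factorial_upper {n : ℕ} (hn : n ≠ 0) :
    Real.log (n.factorial : ℝ) ≤ n * Real.log n - n + Real.log n / 2 + 1 := by
  have h0 : (0 : ℝ) < n := by exact_mod_cast Nat.pos_of_ne_zero hn
  obtain ⟨m, rfl⟩ := Nat.exists_eq_succ_of_ne_zero hn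
  have h := Stirling.stirlingSeq'_antitone (Nat.zero_le m)
  simp only [Function.comp_apply] at h
  have h1 := Real.log_le_log (Stirling.stirlingSeq'_pos m) h
  rw [Stirling.log_stirlingSeq_formula] at h1
  have e : Nat.succ 0 = 1 := rfl
  rw [e, Stirling.stirlingSeq_one, Real.log_div (Real.exp_pos 1).ne' (by positivity), Real.log_exp,
    Real.log_sqrt (by norm_num)] at h1
  change Real.log ((m.succ).factorial : ℝ) - 1 / 2 * Real.log (2 * (m.succ : ℝ)) -
    (m.succ : ℝ) * Real.log ((m.succ : ℝ) / Real.exp 1) ≤ _ at h1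
  rw [Real.log_mul (by norm_num) h0.ne', Real.log_div h0.ne' (Real.exp_pos 1).ne', Real.log_exp] at h1
  linarith

lemma log_Gamma_bounds {q : ℝ} (hq : 2 ≤ q) :
    q * Real.log q - q + Real.log q / 2 - 3 / 2 ≤ Real.log (Real.Gamma (1 + q)) ∧
    Real.log (Real.Gamma (1 + q)) ≤ q * Real.log q - q + Real.log q / 2 + 3 := by
  have hc : 0 < ⌈q⌉₊ := Nat.ceil_pos.2 (by linarith)
  obtain ⟨n, hn⟩ : ∃ n, ⌈q⌉₊ = n + 1 := ⟨⌈q⌉₊ - 1, by omega⟩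
  have hle : q ≤ n + 1 := by
    have := Nat.le_ceil q; rw [hn] at this; exact_mod_cast this
  have hlt : (n : ℝ) < q := by
    have := Nat.ceil_lt_add_one (by linarith : 0 ≤ q); rw [hn] at this; push_cast at this; linarith
  have hn1 : (1 : ℝ) ≤ n := by linarith
  have hn0 : n ≠ 0 := by rintro rfl; norm_num at hn1
  have hx0 : 0 < q - n := by linarith
  have hx1 : q - n ≤ 1 := by linarith
  have up := Real.BohrMollerup.f_add_nat_le Real.convexOn_log_Gamma (@logGamma_feq)
    (Nat.succ_ne_zero n) hx0 hx1
  have lo := Real.BohrMollerup.f_add_nat_ge Real.convexOn_log_Gamma (@logGamma_feq)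
    (by omega : 2 ≤ n + 1) hx0
  simp only [Function.comp_apply, Nat.succ_eq_add_one, Nat.cast_add, Nat.cast_one,
    Real.Gamma_nat_eq_factorial, add_sub_cancel_right] at up lo
  have e : (n : ℝ) + 1 + (q - n) = 1 + q := by ring
  rw [e] at up lo
  have fl := Stirling.le_log_factorial_stirling hn0
  have fu := log_factorial_upper hn0
  have hpi := Real.pi_gt_three
  have hl2 : 0 ≤ Real.log (2 * π) := Real.log_nonneg (by linarith)
  have hnn : 0 ≤ Real.log n := Real.log_nonneg hn1
  have hd : Real.log q ≤ Real.log n + (q - n) / n := by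
    have h := Real.log_le_sub_one_of_pos (by positivity : 0 < q / n)
    rw [Real.log_div (by linarith) (by linarith)] at h
    have : q / n - 1 = (q - n) / n := by field_simp
    linarith
  have hr : (q - n) / n ≤ 1 := by rw [div_le_one (by linarith)]; linarith
  have hr2 : q * ((q - n) / n) ≤ (q - n) + 1 := by
    have : q * ((q - n) / n) = (q - n) + (q - n) * ((q - n) / n) := by field_simp; ring
    have h5 : (q - n) * ((q - n) / n) ≤ 1 * 1 := by
      apply mul_le_mul hx1 hr (by positivity) (by norm_num)
    linarith
  have hnq : Real.log n ≤ Real.log q := Real.log_le_log (by linarith) hlt.le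
  have hn1q : Real.log (n + 1) ≤ Real.log q + 1 := by
    have h := Real.log_le_sub_one_of_pos (by positivity : 0 < ((n : ℝ) + 1) / q)
    rw [Real.log_div (by linarith) (by linarith)] at h
    have : ((n : ℝ) + 1) / q ≤ 2 := by rw [div_le_iff₀ (by linarith)]; linarith
    linarith
  constructor
  · have : q * Real.log q ≤ q * Real.log n + q * ((q - n) / n) := by nlinarith
    linarith
  · have h1 : (n : ℝ) * Real.log n ≤ n * Real.log q := by gcongr
    have h2 : (q - n) * Real.log (n + 1) ≤ (q - n) * (Real.log q + 1) := by gcongr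
    linarith

lemma B_bounds {q : ℝ} (hq : 28 ≤ q) (hlog : 13 ≤ Real.log q) :
    ∃ B : ℝ, 0 < B ∧ B ^ q = 2 * Q q ∧ 4 * π * B ≤ q ∧
      q + Real.log q / 2 - 5 / 2 ≤ 2 * B * (π * Real.exp 1) ∧
      2 * B * (π * Real.exp 1) ≤ q + Real.log q + 6 := by
  have hQ := Q_pos (by linarith : 0 < q)
  have hq0 : 0 < q := by linarith
  have hpi := Real.pi_gt_three
  have hpi4 := Real.pi_lt_four
  have hG := Real.Gamma_pos_of_pos (by linarith : 0 < 1 + q)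
  obtain ⟨gl, gu⟩ := log_Gamma_bounds (by linarith : 2 ≤ q)
  set X : ℝ := (Real.log (2 * Q q)) / q - Real.log q + 1 + Real.log (2 * π) with hX
  have hlogQ : Real.log (2 * Q q) = Real.log 4 + Real.log (Real.Gamma (1 + q)) -
      (1 + q) * Real.log (2 * π) := by
    have : 2 * Q q = 4 * Real.Gamma (1 + q) / (2 * π) ^ (1 + q) := by unfold Q; ring
    rw [this, Real.log_div (by positivity) (by positivity), Real.log_mul (by norm_num) hG.ne',
      Real.log_rpow (by positivity)]
  have hqX : q * X = Real.log (Real.Gamma (1 + q)) - (q * Real.log q - q) +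
      (Real.log 4 - Real.log (2 * π)) := by
    have : q * X = Real.log (2 * Q q) - q * Real.log q + q + q * Real.log (2 * π) := by
      rw [hX]; field_simp
    rw [this, hlogQ]; ring
  have hc1 : Real.log 4 - Real.log (2 * π) ≤ 0 := by
    have := Real.log_le_log (by norm_num) (by linarith : (4 : ℝ) ≤ 2 * π)
    linarith
  have hc2 : -1 ≤ Real.log 4 - Real.log (2 * π) := by
    have h := Real.log_le_log (by positivity) (by linarith : 2 * π ≤ 4 * 2)
    rw [Real.log_mul (x := 4) (y := 2) (by norm_num) (by norm_num)] at h
    have : Real.log 2 ≤ 1 := by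
      have := Real.log_le_sub_one_of_pos (by norm_num : (0 : ℝ) < 2)
      linarith
    linarith
  have hlu : Real.log q ≤ q / 4 + 1 := by
    have h := Real.log_le_sub_one_of_pos (by positivity : 0 < q / 4)
    rw [Real.log_div (by linarith) (by norm_num)] at h
    have h4 : Real.log 4 ≤ 2 := by
      have : (4 : ℝ) = 2 ^ 2 := by norm_num
      rw [this, Real.log_pow]
      have := Real.log_le_sub_one_of_pos (by norm_num : (0 : ℝ) < 2)
      push_cast; linarith
    linarith
  have X0 : 0 ≤ X := by
    have : 0 ≤ q * X := by linarith
    exact nonneg_of_mul_nonneg_right this hq0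
  have X4 : X ≤ 1 / 4 := by
    have : q * X ≤ q * (1 / 4) := by linarith
    exact le_of_mul_le_mul_left this hq0
  refine ⟨Real.exp (Real.log (2 * Q q) / q), Real.exp_pos _, ?_, ?_⟩
  · rw [← Real.exp_mul, div_mul_cancel₀ _ hq0.ne', Real.exp_log (by positivity)]
  have hBe : Real.exp (Real.log (2 * Q q) / q) * (2 * π) * Real.exp 1 = q * Real.exp X := by
    have : Real.log (2 * Q q) / q = X + Real.log q - 1 - Real.log (2 * π) := by rw [hX]; ring
    rw [this, Real.exp_sub, Real.exp_sub, Real.exp_add, Real.exp_log hq0,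
      Real.exp_log (by positivity)]
    field_simp
  set B := Real.exp (Real.log (2 * Q q) / q) with hB
  have he := Real.exp_one_gt_d9
  have hXl := Real.add_one_le_exp X
  have hXu : Real.exp X * (1 - X) ≤ 1 := by
    have h := Real.add_one_le_exp (-X)
    calc Real.exp X * (1 - X) ≤ Real.exp X * Real.exp (-X) := by gcongr; linarith
      _ = 1 := by rw [← Real.exp_add]; simp
  have hXu2 : Real.exp X ≤ 1 + 2 * X := by
    have h0 : 1 ≤ (1 + 2 * X) * (1 - X) := by nlinarith
    have h1 : 0 < 1 - X := by linarith
    exact le_of_mul_le_mul_right (by linarith) h1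
  have hXu3 : Real.exp X ≤ 4 / 3 := by nlinarith [Real.exp_pos X]
  refine ⟨?_, ?_, ?_⟩
  · have h1 : 4 * π * B * Real.exp 1 = q * (2 * Real.exp X) := by linarith
    have h2 : q * (2 * Real.exp X) ≤ q * Real.exp 1 := by gcongr; linarith
    exact le_of_mul_le_mul_right (h1.trans_le h2) (Real.exp_pos 1)
  · have : 2 * B * (π * Real.exp 1) = q * Real.exp X := by linarith
    rw [this]
    have := mul_le_mul_of_nonneg_left hXl hq0.le
    linarith
  · have : 2 * B * (π * Real.exp 1) = q * Real.exp X := by linarith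
    rw [this]
    have := mul_le_mul_of_nonneg_left hXu2 hq0.le
    linarith

theorem stmt_4 :
    ∃ P : ℝ, ∀ p : ℝ, P < p →
      {a : ℝ | 0 < a ∧ zetaH p a = 0}.Finite ∧
      (p - 1) / (π * Real.exp 1) - 1 < ({a : ℝ | 0 < a ∧ zetaH p a = 0}.ncard : ℝ) ∧
      ({a : ℝ | 0 < a ∧ zetaH p a = 0}.ncard : ℝ) <
        (p - 1) / (π * Real.exp 1) + (1 / 2) * Real.log p + 2 * π * Real.exp 1 + 2 := by
  refine ⟨33 + Real.exp 13, fun p hp => ?_⟩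
  obtain ⟨q, rfl⟩ : ∃ q, p = q + 5 := ⟨p - 5, by ring⟩
  have h13 := Real.exp_pos 13
  have hq : 28 ≤ q := by linarith
  have hlog : 13 ≤ Real.log q := by
    rw [Real.le_log_iff_exp_le (by linarith)]; linarith
  obtain ⟨B, hB, hBQ, hB2, hl, hu⟩ := B_bounds hq hlog
  obtain ⟨hf, h1, h2⟩ := count_bounds (by linarith) hB hBQ hB2
  have hpi := Real.pi_gt_three
  have he := Real.exp_one_gt_d9
  have hK : 8 ≤ π * Real.exp 1 := by nlinarith
  have hlog5 : Real.log q ≤ Real.log (q + 5) := Real.log_le_log (by linarith) (by linarith)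
  refine ⟨hf, ?_, ?_⟩
  · refine lt_of_lt_of_le ?_ h1
    rw [sub_lt_iff_lt_add, div_lt_iff₀ (by linarith)]
    linarith
  · refine lt_of_le_of_lt h2 ?_
    have hK0 : 0 < π * Real.exp 1 := by linarith
    have h3 : 2 * B ≤ (q + Real.log q + 6) / (π * Real.exp 1) := by
      rw [le_div_iff₀ hK0]; exact hu
    have h4 : (q + Real.log q + 6) / (π * Real.exp 1) =
        (q + 5 - 1) / (π * Real.exp 1) + (Real.log q + 2) / (π * Real.exp 1) := by
      rw [← add_div]; congr 1; ring
    have h5 : (Real.log q + 2) / (π * Real.exp 1) ≤ (Real.log q + 2) / 8 := by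
      apply div_le_div_of_nonneg_left (by linarith) (by norm_num) hK
    linarith
end

section
/- For every real α > 0 there exists a threshold P such that for every real p > P, every integer n with 1 ≤ n and n < α·p, and every real b ∈ (0,1], one has |ζ(-p, n+b) − hurwitzZeta(−p) b| / Q(p) < (2πen/p)^p · (π/√(2πp)) · 1/(1 − e^{−1/α}). -/
open Real HurwitzZeta

theorem aux_step (y : ℝ) (hy : 0 < y) :
    Real.log (y + 1) ≤ ((y + 1 + 1 / 2) * Real.log (y + 1) - (y + 1)) -
      ((y + 1 / 2) * Real.log y - y) := by
  have h := Real.le_log_one_add_of_nonneg (x := 1 / y) (by positivity)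
  have e : 1 + 1 / y = (y + 1) / y := by field_simp
  rw [e, Real.log_div (by positivity) (by positivity)] at h
  have e2 : 2 * (1 / y) / (1 / y + 2) = 1 / (y + 1 / 2) := by
    field_simp
    ring
  rw [e2, div_le_iff₀ (by positivity)] at h
  nlinarith

theorem aux_sum (x : ℝ) (hx : 0 < x) (n : ℕ) :
    ∑ m ∈ Finset.range (n + 1), Real.log (x + m) ≤ Real.log x +
      ((x + n + 1 / 2) * Real.log (x + n) - (x + n)) - ((x + 1 / 2) * Real.log x - x) := by
  induction n with
  | zero => simp
  | succ k ih =>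
    rw [Finset.sum_range_succ]
    have h := aux_step (x + k) (by positivity)
    push_cast
    rw [← add_assoc x]
    linarith

theorem aux_seq (x : ℝ) (hx : 0 < x) (n : ℕ) (hn : n ≠ 0) :
    (x + 1 / 2) * Real.log x - x - Real.log x + Real.log (2 * π) / 2
      - x * (x + 1 / 2) / n ≤ Real.BohrMollerup.logGammaSeq x n := by
  have hn' : (0 : ℝ) < n := by positivity
  have h1 := aux_sum x hx n
  have h2 := Stirling.le_log_factorial_stirling hn
  have h3 := Real.log_le_sub_one_of_pos (x := (x + n) / n) (by positivity)
  rw [Real.log_div (by positivity) (by positivity)] at h3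
  have h4 : (x + n) / n - 1 = x / n := by field_simp; ring
  rw [h4] at h3
  have h5 := mul_le_mul_of_nonneg_left h3 (show 0 ≤ x + n + 1 / 2 by positivity)
  have h6 : (x + n + 1 / 2) * (x / n) = x + x * (x + 1 / 2) / n := by field_simp; ring
  rw [h6] at h5
  unfold Real.BohrMollerup.logGammaSeq
  linarith

theorem aux_log (x : ℝ) (hx : 0 < x) :
    (x + 1 / 2) * Real.log x - x - Real.log x + Real.log (2 * π) / 2 ≤
      Real.log (Real.Gamma x) := by
  have h := Real.BohrMollerup.tendsto_log_gamma hx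
  have h2 : Filter.Tendsto (fun n : ℕ => (x + 1 / 2) * Real.log x - x - Real.log x +
      Real.log (2 * π) / 2 - x * (x + 1 / 2) / n) Filter.atTop
      (nhds ((x + 1 / 2) * Real.log x - x - Real.log x + Real.log (2 * π) / 2 - 0)) :=
    tendsto_const_nhds.sub (tendsto_const_div_atTop_nhds_zero_nat _)
  rw [sub_zero] at h2
  refine le_of_tendsto_of_tendsto h2 h ?_
  filter_upwards [Filter.eventually_ne_atTop 0] with n hn using aux_seq x hx n hn

theorem aux_gamma (x : ℝ) (hx : 0 < x) :
    Real.sqrt (2 * π * x) * (x / Real.exp 1) ^ x ≤ Real.Gamma (1 + x) := by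
  have hG := Real.Gamma_pos_of_pos hx
  rw [add_comm, Real.Gamma_add_one hx.ne']
  rw [← Real.log_le_log_iff (by positivity) (by positivity),
    Real.log_mul (by positivity) (by positivity), Real.log_mul (by positivity) (by positivity),
    Real.log_sqrt (by positivity), Real.log_mul (by positivity) (by positivity),
    Real.log_rpow (by positivity), Real.log_div (by positivity) (by positivity), Real.log_exp]
  have := aux_log x hx
  linarith

theorem aux_pow (α : ℝ) (hα : 0 < α) (p : ℝ) (hp : 0 < p) (n : ℕ) (hn : 1 ≤ n)
    (hnp : (n : ℝ) < α * p) (b : ℝ) (hb : 0 < b) (hb1 : b ≤ 1) :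
    ∑ r ∈ Finset.range n, ((r : ℝ) + b) ^ p < (n : ℝ) ^ p * (1 / (1 - Real.exp (-1 / α))) := by
  have hn' : (0 : ℝ) < n := by exact_mod_cast hn
  have hq1 : Real.exp (-1 / α) < 1 := by
    rw [Real.exp_lt_one_iff]
    exact div_neg_of_neg_of_pos (by norm_num) hα
  have hq0 := Real.exp_pos (-1 / α)
  set q := Real.exp (-1 / α) with hq
  rw [← Finset.sum_range_reflect]
  have key : ∀ j ∈ Finset.range n, (((n - 1 - j : ℕ) : ℝ) + b) ^ p ≤ (n : ℝ) ^ p * q ^ j := by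
    intro j hj
    have hj' : j < n := Finset.mem_range.mp hj
    have hjr : (j : ℝ) + 1 ≤ n := by exact_mod_cast hj'
    have e : ((n - 1 - j : ℕ) : ℝ) = n - 1 - j := by
      rw [Nat.sub_sub, Nat.cast_sub (by omega)]
      push_cast
      ring
    have hb2 : ((n - 1 - j : ℕ) : ℝ) + b ≤ n * Real.exp (-(j / n)) := by
      have h := Real.add_one_le_exp (-((j : ℝ) / n))
      have h2 := mul_le_mul_of_nonneg_left h hn'.le
      have h3 : (n : ℝ) * (-((j : ℝ) / n) + 1) = n - j := by field_simp; ring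
      rw [h3] at h2
      rw [e]
      linarith
    calc (((n - 1 - j : ℕ) : ℝ) + b) ^ p ≤ (n * Real.exp (-(j / n))) ^ p :=
          Real.rpow_le_rpow (by positivity) hb2 hp.le
      _ = (n : ℝ) ^ p * Real.exp (-(j / n) * p) := by
          rw [Real.mul_rpow hn'.le (Real.exp_pos _).le, ← Real.exp_mul]
      _ ≤ (n : ℝ) ^ p * q ^ j := by
          gcongr
          rw [hq, ← Real.exp_nat_mul]
          apply Real.exp_le_exp.mpr
          have h1 : 1 / α ≤ p / n := by
            rw [div_le_div_iff₀ hα hn']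
            linarith
          have h2 := mul_le_mul_of_nonneg_left h1 (Nat.cast_nonneg (α := ℝ) j)
          have h3 : -((j : ℝ) / n) * p = -(j * (p / n)) := by ring
          have h4 : (j : ℝ) * (-1 / α) = -(j * (1 / α)) := by ring
          rw [h3, h4]
          linarith
  refine (Finset.sum_le_sum key).trans_lt ?_
  rw [← Finset.mul_sum]
  apply mul_lt_mul_of_pos_left _ (by positivity)
  rw [geom_sum_eq hq1.ne, ← neg_div_neg_eq]
  rw [neg_sub, neg_sub]
  apply div_lt_div_of_pos_right _ (by linarith)
  have : 0 < q ^ n := by positivity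
  linarith

theorem stmt_9 (α : ℝ) (hα : 0 < α) :
    ∃ P : ℝ, ∀ p : ℝ, P < p → ∀ n : ℕ, 1 ≤ n → (n : ℝ) < α * p →
      ∀ b : ℝ, 0 < b → b ≤ 1 →
        |zetaH p ((n : ℝ) + b) - hzeta (-p) b| / Q p <
          (2 * π * Real.exp 1 * n / p) ^ p * (π / Real.sqrt (2 * π * p)) *
            (1 / (1 - Real.exp (-1 / α))) := by
  refine ⟨0, fun p hp n hn hnp b hb hb1 => ?_⟩
  have hn' : (0 : ℝ) < n := by exact_mod_cast hn
  have hc : ⌈(n : ℝ) + b⌉₊ = n + 1 := by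
    rw [Nat.ceil_eq_iff (by omega)]
    push_cast
    constructor <;> linarith
  have hz : zetaH p ((n : ℝ) + b) - hzeta (-p) b =
      -∑ r ∈ Finset.range n, ((r : ℝ) + b) ^ p := by
    unfold zetaH
    rw [hc, Nat.add_sub_cancel, add_sub_cancel_left]
    ring
  have hS : 0 ≤ ∑ r ∈ Finset.range n, ((r : ℝ) + b) ^ p :=
    Finset.sum_nonneg fun r _ => by positivity
  rw [hz, abs_neg, abs_of_nonneg hS]
  have hlt := aux_pow α hα p hp n hn hnp b hb hb1
  have hG := aux_gamma p hp
  set S := ∑ r ∈ Finset.range n, ((r : ℝ) + b) ^ p with hSdef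
  set K := 1 / (1 - Real.exp (-1 / α)) with hK
  have hGpos : 0 < Real.Gamma (1 + p) := Real.Gamma_pos_of_pos (by linarith)
  have hQ : Q p = Real.Gamma (1 + p) / (π * (2 * π) ^ p) := by
    unfold Q
    rw [Real.rpow_add (by positivity), Real.rpow_one]
    field_simp
  have hK0 : 0 < (n : ℝ) ^ p * K := hS.trans_lt hlt
  have hpow : (2 * π * Real.exp 1 * n / p) ^ p =
      (2 * π) ^ p * (n : ℝ) ^ p / (p / Real.exp 1) ^ p := by
    rw [← Real.mul_rpow (by positivity) (by positivity),
      ← Real.div_rpow (by positivity) (by positivity)]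
    congr 1
    field_simp
  have hD : 0 < Real.sqrt (2 * π * p) * (p / Real.exp 1) ^ p := by positivity
  calc S / Q p < ((n : ℝ) ^ p * K) / Q p := by
        apply div_lt_div_of_pos_right hlt
        rw [hQ]
        positivity
    _ = ((n : ℝ) ^ p * K) * (π * (2 * π) ^ p) / Real.Gamma (1 + p) := by
        rw [hQ]
        field_simp
    _ ≤ ((n : ℝ) ^ p * K) * (π * (2 * π) ^ p) /
          (Real.sqrt (2 * π * p) * (p / Real.exp 1) ^ p) := by
        apply div_le_div_of_nonneg_left _ hD hG
        positivity
    _ = _ := by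
        rw [hpow]
        ring
end
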